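/- Fix (i,j) ∈ E, buyer bids b, and sellers' bids s_{-j}. Then the set C := {c ∈ ℝ : (i,j) ∈ M*(b, (c, s_{-j}))} is a lower set of ℝ (if c ∈ C and c' ≤ c then c' ∈ C). Consequently, writing c̄_ij(b, s_{-j}) for the critical cost, for every real c < c̄_ij(b, s_{-j}) one has (i,j) ∈ M*(b, (c, s_{-j})), and for every real c > c̄_ij(b, s_{-j}) one has (i,j) ∉ M*(b, (c, s_{-j})) (comparisons taken in ℝ ∪ {−∞,+∞}). -/

import Mathlib

open Finset

noncomputable section

/-- The weight of a set of buyer–seller edges `M` under buyer bids `b` and seller bids `s`: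
`∑_{(i,j)∈M} (b i − s j)`. -/
def matchWeight {m n : ℕ} (b : Fin m → ℝ) (s : Fin n → ℝ)
    (M : Finset (Fin m × Fin n)) : ℝ :=
  ∑ e ∈ M, (b e.1 - s e.2)

/-- A set of edges is a matching: no two distinct edges share a buyer or share a seller. -/
def IsMatching {m n : ℕ} (M : Finset (Fin m × Fin n)) : Prop :=
  ∀ e ∈ M, ∀ e' ∈ M, e ≠ e' → e.1 ≠ e'.1 ∧ e.2 ≠ e'.2

/-- A two-sided matching market with `m` buyers and `n` sellers: a finite edge set `E`,
a nonempty downward-closed family `Fam` of matchings contained in `E`, a fixed strict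
linear tie-breaking order `tb` on `Fam`, and the selection `Mstar b s` of the `tb`-least
maximum-weight member of `Fam`. -/
structure MarketSetup (m n : ℕ) where
  E : Finset (Fin m × Fin n)
  Fam : Finset (Finset (Fin m × Fin n))
  tb : Finset (Fin m × Fin n) → Finset (Fin m × Fin n) → Prop
  Mstar : (Fin m → ℝ) → (Fin n → ℝ) → Finset (Fin m × Fin n)
  empty_mem : ∅ ∈ Fam
  subset_E : ∀ M ∈ Fam, M ⊆ E
  matching : ∀ M ∈ Fam, IsMatching M
  downward_closed : ∀ M ∈ Fam, ∀ M' ⊆ M, M' ∈ Fam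
  tb_irrefl : ∀ M ∈ Fam, ¬ tb M M
  tb_trans : ∀ M₁ ∈ Fam, ∀ M₂ ∈ Fam, ∀ M₃ ∈ Fam, tb M₁ M₂ → tb M₂ M₃ → tb M₁ M₃
  tb_total : ∀ M₁ ∈ Fam, ∀ M₂ ∈ Fam, M₁ ≠ M₂ → tb M₁ M₂ ∨ tb M₂ M₁
  Mstar_mem : ∀ b s, Mstar b s ∈ Fam
  Mstar_max : ∀ b s, ∀ M ∈ Fam, matchWeight b s M ≤ matchWeight b s (Mstar b s)
  Mstar_lt : ∀ b s, ∀ M ∈ Fam,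
      matchWeight b s M = matchWeight b s (Mstar b s) → M ≠ Mstar b s →
      tb (Mstar b s) M

/-- The set of costs `c` of seller `j` for which `(i,j)` lies in the maximum-weight
matching `M*(b, (c, s₋ⱼ))`. -/
def critSet {m n : ℕ} (mk : MarketSetup m n) (i : Fin m) (j : Fin n)
    (b : Fin m → ℝ) (s : Fin n → ℝ) : Set ℝ :=
  {c : ℝ | (i, j) ∈ mk.Mstar b (Function.update s j c)}

/-- The critical cost `c̄_ij(b, s₋ⱼ) = sup {c ∈ ℝ : (i,j) ∈ M*(b, (c, s₋ⱼ))}`,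
taken in the extended reals, with `sup ∅ = −∞`. -/
def critCost {m n : ℕ} (mk : MarketSetup m n) (i : Fin m) (j : Fin n)
    (b : Fin m → ℝ) (s : Fin n → ℝ) : EReal :=
  sSup ((fun x : ℝ => (x : EReal)) '' critSet mk i j b s)

theorem matchWeight_update {m n : ℕ} (b : Fin m → ℝ) (s : Fin n → ℝ) (j : Fin n) (c c' : ℝ)
    (M : Finset (Fin m × Fin n)) :
    matchWeight b (Function.update s j c') M =
      matchWeight b (Function.update s j c) M + #{e ∈ M | e.2 = j} * (c - c') := by
  rw [← nsmul_eq_mul, ← sum_const, sum_filter, matchWeight, matchWeight, ← sum_add_distrib]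
  refine sum_congr rfl fun e _ => ?_
  by_cases h : e.2 = j
  · simp [h]
  · simp [h]

theorem IsMatching.card_filter_seller_le_one {m n : ℕ} {M : Finset (Fin m × Fin n)}
    (hM : IsMatching M) (j : Fin n) : #{e ∈ M | e.2 = j} ≤ 1 := by
  rw [card_le_one]
  intro e he e' he'
  rw [mem_filter] at he he'
  by_contra hne
  exact (hM e he.1 e' he'.1 hne).2 (he.2.trans he'.2.symm)

/-- Two selections that have equal weight under both pairs of bids coincide. -/
theorem MarketSetup.Mstar_eq_of_weight_eq {m n : ℕ} (mk : MarketSetup m n)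
    {b b' : Fin m → ℝ} {s s' : Fin n → ℝ}
    (h : matchWeight b s (mk.Mstar b' s') = matchWeight b s (mk.Mstar b s))
    (h' : matchWeight b' s' (mk.Mstar b s) = matchWeight b' s' (mk.Mstar b' s')) :
    mk.Mstar b s = mk.Mstar b' s' := by
  by_contra hne
  have hM := mk.Mstar_mem b s
  have hM' := mk.Mstar_mem b' s'
  exact mk.tb_irrefl _ hM (mk.tb_trans _ hM _ hM' _ hM
    (mk.Mstar_lt b s _ hM' h (Ne.symm hne)) (mk.Mstar_lt b' s' _ hM h' hne))

theorem isLowerSet_critSet {m n : ℕ} (mk : MarketSetup m n) (i : Fin m) (j : Fin n)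
    (b : Fin m → ℝ) (s : Fin n → ℝ) : IsLowerSet (critSet mk i j b s) := by
  intro c c' hcc' hc
  simp only [critSet, Set.mem_ofPred_eq] at hc ⊢
  have hM := mk.Mstar_mem b (Function.update s j c)
  have hM' := mk.Mstar_mem b (Function.update s j c')
  have hmax := mk.Mstar_max b (Function.update s j c) _ hM'
  have hmax' := mk.Mstar_max b (Function.update s j c') _ hM
  have hw := matchWeight_update b s j c c' (mk.Mstar b (Function.update s j c))
  have hw' := matchWeight_update b s j c c' (mk.Mstar b (Function.update s j c'))
  have hcard : #{e ∈ mk.Mstar b (Function.update s j c) | e.2 = j} = 1 :=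
    le_antisymm ((mk.matching _ hM).card_filter_seller_le_one j)
      (card_pos.2 ⟨(i, j), mem_filter.2 ⟨hc, rfl⟩⟩)
  have hcard' : (#{e ∈ mk.Mstar b (Function.update s j c') | e.2 = j} : ℝ) ≤ 1 :=
    mod_cast (mk.matching _ hM').card_filter_seller_le_one j
  have hle := mul_le_mul_of_nonneg_right hcard' (sub_nonneg.2 hcc')
  rw [hcard, Nat.cast_one] at hw
  rwa [← mk.Mstar_eq_of_weight_eq (b := b) (b' := b) (s := Function.update s j c)
    (s' := Function.update s j c') (by linarith) (by linarith)]

/-- For fixed `(i,j) ∈ E`, buyer bids `b`, and other sellers' bids `s₋ⱼ`,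
the set `C = {c : (i,j) ∈ M*(b,(c,s₋ⱼ))}` is a lower set of `ℝ`; consequently every real
`c` below the critical cost lies in `C` and every real `c` above it does not. -/
theorem critSet_lower_and_critCost_threshold {m n : ℕ} (mk : MarketSetup m n)
    (i : Fin m) (j : Fin n) (hE : (i, j) ∈ mk.E)
    (b : Fin m → ℝ) (s : Fin n → ℝ) :
    (∀ c ∈ critSet mk i j b s, ∀ c' : ℝ, c' ≤ c → c' ∈ critSet mk i j b s) ∧
    (∀ c : ℝ, (c : EReal) < critCost mk i j b s → c ∈ critSet mk i j b s) ∧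
    (∀ c : ℝ, critCost mk i j b s < (c : EReal) → c ∉ critSet mk i j b s) := by
  have hlow := isLowerSet_critSet mk i j b s
  refine ⟨fun c hc c' h => hlow h hc, fun c hc => ?_, fun c hc hmem => ?_⟩
  · obtain ⟨_, ⟨x, hx, rfl⟩, hcx⟩ := lt_sSup_iff.1 hc
    exact hlow (EReal.coe_lt_coe_iff.1 hcx).le hx
  · exact hc.not_ge (le_sSup (Set.mem_image_of_mem _ hmem))
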